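/- Let Q, R ∈ ℝ^{r×d} with ‖Q‖_F ≤ κ and ‖R‖_F ≤ κ, suppose RᵀR is positive definite with λ·I ⪯ RᵀR for some λ > 0, and let R_S ∈ ℝ^{r×d}, Q_S ∈ ℝ^{r×d} be fixed matrices. Set Λ = R_S (RᵀR)⁻¹ Rᵀ Q, V = ΛᵀΛ − ΛᵀQ_S − Q_SᵀΛ, and K' = ‖R_S‖_F · d · κ² / λ. Then for every d×d positive semidefinite matrix Σ_e, every ε > 0, and every β ∈ [0,1]: ‖(1−β)V + β(Σ_e + εI)⁻¹‖_F ≤ (1−β)(K'² + 2K'‖Q_S‖_F) + β√d/ε. In particular, the gradient of the per-round sender cost J(Σ_e) = −(1−β)Tr(VΣ_e) − β log det(Σ_e + εI) is bounded in Frobenius norm uniformly over receiver types. (Gradient bound established in the proof of Lemma 4.) -/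

import Mathlib

open Matrix

/-- The Frobenius norm of a real matrix. -/
noncomputable def frobNorm {m n : ℕ} (A : Matrix (Fin m) (Fin n) ℝ) : ℝ :=
  Real.sqrt (∑ i, ∑ j, (A i j) ^ 2)

open scoped Matrix.Norms.Frobenius in
theorem frobNorm_eq_norm {m n : ℕ} (A : Matrix (Fin m) (Fin n) ℝ) : frobNorm A = ‖A‖ := by
  simp [frobNorm, frobenius_norm_def, Real.sqrt_eq_rpow]

theorem frobNorm_nonneg {m n : ℕ} (A : Matrix (Fin m) (Fin n) ℝ) : 0 ≤ frobNorm A :=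
  Real.sqrt_nonneg _

theorem frobNorm_transpose {m n : ℕ} (A : Matrix (Fin m) (Fin n) ℝ) :
    frobNorm Aᵀ = frobNorm A := by
  simp only [frobNorm_eq_norm, frobenius_norm_transpose]

theorem frobNorm_mul_le {m n k : ℕ} (A : Matrix (Fin m) (Fin n) ℝ)
    (B : Matrix (Fin n) (Fin k) ℝ) : frobNorm (A * B) ≤ frobNorm A * frobNorm B := by
  simpa only [frobNorm_eq_norm] using frobenius_norm_mul A B

open scoped Matrix.Norms.Frobenius in
theorem frobNorm_add_le {m n : ℕ} (A B : Matrix (Fin m) (Fin n) ℝ) :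
    frobNorm (A + B) ≤ frobNorm A + frobNorm B := by
  simpa only [frobNorm_eq_norm] using norm_add_le A B

open scoped Matrix.Norms.Frobenius in
theorem frobNorm_sub_le {m n : ℕ} (A B : Matrix (Fin m) (Fin n) ℝ) :
    frobNorm (A - B) ≤ frobNorm A + frobNorm B := by
  simpa only [frobNorm_eq_norm] using norm_sub_le A B

open scoped Matrix.Norms.Frobenius in
theorem frobNorm_smul {m n : ℕ} {c : ℝ} (hc : 0 ≤ c) (A : Matrix (Fin m) (Fin n) ℝ) :
    frobNorm (c • A) = c * frobNorm A := by
  rw [frobNorm_eq_norm, frobNorm_eq_norm, norm_smul, Real.norm_of_nonneg hc]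

/-- A matrix bounded below by `c • 1` with `c > 0` has an inverse of Frobenius norm at most
`√d / c`. -/
theorem frobNorm_inv_le {d : ℕ} {M : Matrix (Fin d) (Fin d) ℝ} {c : ℝ} (hc : 0 < c)
    (h : (M - c • (1 : Matrix (Fin d) (Fin d) ℝ)).PosSemidef) :
    frobNorm M⁻¹ ≤ Real.sqrt d / c := by
  have hM : M.PosDef := by
    simpa using PosDef.posSemidef_add h (PosDef.one.smul hc)
  have hdet : IsUnit M.det := (isUnit_iff_isUnit_det _).mp hM.isUnit
  have hcol : ∀ j, ∑ i, (M⁻¹ i j) ^ 2 ≤ 1 / c ^ 2 := by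
    intro j
    set x : Fin d → ℝ := fun i => M⁻¹ i j
    have hMx : M *ᵥ x = Pi.single j 1 := by
      have : x = M⁻¹ *ᵥ Pi.single j 1 := by ext i; simp [x]
      rw [this, mulVec_mulVec, mul_nonsing_inv _ hdet, one_mulVec]
    have hquad := h.dotProduct_mulVec_nonneg x
    rw [sub_mulVec, hMx, smul_mulVec, one_mulVec, dotProduct_sub, dotProduct_smul] at hquad
    have hdot : star x ⬝ᵥ x = ∑ i, x i ^ 2 := by simp [dotProduct, sq]
    rw [hdot] at hquad
    simp only [star_trivial, dotProduct_single, mul_one, smul_eq_mul] at hquad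
    change ∑ i, x i ^ 2 ≤ 1 / c ^ 2
    have hxj : x j ^ 2 ≤ ∑ i, x i ^ 2 :=
      Finset.single_le_sum (f := fun i => x i ^ 2) (fun i _ => sq_nonneg _) (Finset.mem_univ j)
    generalize ∑ i, x i ^ 2 = s at hquad hxj ⊢
    rcases le_or_gt s 0 with hs | hs
    · exact hs.trans (by positivity)
    · have hsq : (c * s) ^ 2 ≤ x j ^ 2 :=
        pow_le_pow_left₀ (by positivity) (by linarith) 2
      rw [le_div_iff₀ (by positivity)]
      refine le_of_mul_le_mul_right ?_ hs
      linarith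
  have hsum : ∑ i, ∑ j, (M⁻¹ i j) ^ 2 ≤ d * (1 / c ^ 2) := by
    rw [Finset.sum_comm]
    simpa using Finset.sum_le_sum fun j (_ : j ∈ Finset.univ) => hcol j
  calc frobNorm M⁻¹ ≤ Real.sqrt (d * (1 / c ^ 2)) := Real.sqrt_le_sqrt hsum
    _ = Real.sqrt d / c := by
      rw [mul_one_div, Real.sqrt_div (Nat.cast_nonneg d), Real.sqrt_sq hc.le]

/-- Gradient bound established in the proof of Lemma 4: with `Λ = R_S(RᵀR)⁻¹RᵀQ`,
`V = ΛᵀΛ − ΛᵀQ_S − Q_SᵀΛ` and `K' = ‖R_S‖_F d κ²/λ`, the gradient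
`(1−β)V + β(Σₑ + εI)⁻¹` of the per-round sender cost is bounded in Frobenius norm by
`(1−β)(K'² + 2K'‖Q_S‖_F) + β√d/ε`, uniformly over receiver types. -/
theorem stmt_8 {r d : ℕ} (Q R RS QS : Matrix (Fin r) (Fin d) ℝ) (κ l : ℝ)
    (hQ : frobNorm Q ≤ κ) (hR : frobNorm R ≤ κ) (hl : 0 < l)
    (hRR : (Rᵀ * R).PosDef)
    (hlb : (Rᵀ * R - l • (1 : Matrix (Fin d) (Fin d) ℝ)).PosSemidef) :
    ∀ Se : Matrix (Fin d) (Fin d) ℝ, Se.PosSemidef → ∀ ε : ℝ, 0 < ε →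
      ∀ β : ℝ, β ∈ Set.Icc (0 : ℝ) 1 →
      frobNorm ((1 - β) • (((RS * (Rᵀ * R)⁻¹ * Rᵀ * Q)ᵀ * (RS * (Rᵀ * R)⁻¹ * Rᵀ * Q)
            - (RS * (Rᵀ * R)⁻¹ * Rᵀ * Q)ᵀ * QS
            - QSᵀ * (RS * (Rᵀ * R)⁻¹ * Rᵀ * Q)))
          + β • (Se + ε • (1 : Matrix (Fin d) (Fin d) ℝ))⁻¹) ≤
        (1 - β) * ((frobNorm RS * d * κ ^ 2 / l) ^ 2
            + 2 * (frobNorm RS * d * κ ^ 2 / l) * frobNorm QS)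
          + β * Real.sqrt d / ε := by
  intro Se hSe ε hε β hβ
  have hβ0 : 0 ≤ 1 - β := sub_nonneg.mpr hβ.2
  set L := RS * (Rᵀ * R)⁻¹ * Rᵀ * Q
  set K := frobNorm RS * d * κ ^ 2 / l with hK
  have hκ : 0 ≤ κ := (frobNorm_nonneg Q).trans hQ
  have hsqrt : Real.sqrt d ≤ d := by
    rw [Real.sqrt_le_left (Nat.cast_nonneg d)]
    exact_mod_cast Nat.le_self_pow two_ne_zero d
  have hL : frobNorm L ≤ K := by
    have hinv : frobNorm (Rᵀ * R)⁻¹ ≤ d / l :=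
      (frobNorm_inv_le hl hlb).trans (by gcongr)
    have hRS := frobNorm_nonneg RS
    calc frobNorm L
        ≤ frobNorm RS * frobNorm (Rᵀ * R)⁻¹ * frobNorm Rᵀ * frobNorm Q := by
          refine (frobNorm_mul_le _ _).trans (mul_le_mul_of_nonneg_right ?_ (frobNorm_nonneg Q))
          refine (frobNorm_mul_le _ _).trans (mul_le_mul_of_nonneg_right ?_ (frobNorm_nonneg Rᵀ))
          exact frobNorm_mul_le _ _
      _ ≤ frobNorm RS * (d / l) * κ * κ := by
          rw [frobNorm_transpose]
          have := frobNorm_nonneg Q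
          have := frobNorm_nonneg R
          gcongr
      _ = K := by rw [hK]; ring
  have hL0 := frobNorm_nonneg L
  have hQS := frobNorm_nonneg QS
  have hV : frobNorm (Lᵀ * L - Lᵀ * QS - QSᵀ * L) ≤ K ^ 2 + 2 * K * frobNorm QS := by
    calc frobNorm (Lᵀ * L - Lᵀ * QS - QSᵀ * L)
        ≤ frobNorm (Lᵀ * L) + frobNorm (Lᵀ * QS) + frobNorm (QSᵀ * L) :=
          (frobNorm_sub_le _ _).trans (by gcongr; exact frobNorm_sub_le _ _)
      _ ≤ frobNorm Lᵀ * frobNorm L + frobNorm Lᵀ * frobNorm QS + frobNorm QSᵀ * frobNorm L := by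
          gcongr <;> exact frobNorm_mul_le _ _
      _ = frobNorm L ^ 2 + 2 * frobNorm L * frobNorm QS := by
          rw [frobNorm_transpose, frobNorm_transpose]; ring
      _ ≤ K ^ 2 + 2 * K * frobNorm QS := by gcongr
  have hinv : frobNorm (Se + ε • (1 : Matrix (Fin d) (Fin d) ℝ))⁻¹ ≤ Real.sqrt d / ε :=
    frobNorm_inv_le hε (by simpa using hSe)
  refine (frobNorm_add_le _ _).trans ?_
  rw [frobNorm_smul hβ0, frobNorm_smul hβ.1, mul_div_assoc]
  exact add_le_add (mul_le_mul_of_nonneg_left hV hβ0) (mul_le_mul_of_nonneg_left hinv hβ.1)
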